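/- Let 𝐀 be a regular BBL transformation of bandwidth (p,q) on V_d^S, let z_1, …, z_n be the distinct nonzero roots of w^{−dp} det A(w,w⁻¹) with multiplicities s_1, …, s_n, and let M = Ker(P_{1−p',∞} 𝐀 |_{V_{1,∞}}) be the bulk solution space of the infinite banded block-Toeplitz transformation A = P_{1,∞} 𝐀 |_{V_{1,∞}}. Let F_1^− = {Ψ ∈ M : (P_{1,∞}T)^k Ψ = 0 for some k} be the generalized kernel of the unilateral shift on M. Then the space of square-summable solutions of the bulk equation is M ∩ H = F_1^− ⊕ P_{1,∞} (⨁_{ℓ : |z_ℓ| < 1} (Ker 𝐀 ∩ T_{z_ℓ, s_ℓ})). -/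

import Mathlib

noncomputable section

/-- The space of doubly-infinite sequences with values in `ℂ^d`. -/
abbrev SeqSp (d : ℕ) : Type := ℤ → Fin d → ℂ

/-- The shift `(Ψ_j)_j ↦ (Ψ_{j+n})_j`; for `n = 1` this is the left shift `T`. -/
def shiftBy (d : ℕ) (n : ℤ) : Module.End ℂ (SeqSp d) where
  toFun Ψ := fun j => Ψ (j + n)
  map_add' _ _ := rfl
  map_smul' _ _ := rfl

/-- Entrywise multiplication of a sequence by a fixed `d × d` matrix. -/
def matOp (d : ℕ) (m : Matrix (Fin d) (Fin d) ℂ) : Module.End ℂ (SeqSp d) where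
  toFun Ψ := fun j => m.mulVec (Ψ j)
  map_add' Ψ Φ := by funext j; simp [Matrix.mulVec_add]
  map_smul' c Ψ := by funext j; simp [Matrix.mulVec_smul]

/-- The banded block-Laurent (BBL) transformation `(𝐀Ψ)_j = ∑_{r=p}^{q} a_r ψ_{j+r}`. -/
def bbl (d : ℕ) (a : ℤ → Matrix (Fin d) (Fin d) ℂ) (p q : ℤ) : Module.End ℂ (SeqSp d) :=
  ∑ r ∈ Finset.Icc p q, matOp d (a r) * shiftBy d r

/-- The projection `P_S` replacing every entry with index outside `S` by zero. -/
def projOn (d : ℕ) (S : Set ℤ) : Module.End ℂ (SeqSp d) where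
  toFun Ψ := fun j => S.indicator Ψ j
  map_add' Ψ Φ := by
    funext j
    by_cases h : j ∈ S <;> simp [Set.indicator_apply, h]
  map_smul' c Ψ := by
    funext j
    by_cases h : j ∈ S <;> simp [Set.indicator_apply, h]

/-- The window `{j : ℤ | Lb ≤ j ≤ Rb}`, with possibly infinite endpoints. -/
def windowSet (Lb : WithBot ℤ) (Rb : WithTop ℤ) : Set ℤ :=
  {j : ℤ | Lb ≤ (j : WithBot ℤ) ∧ (j : WithTop ℤ) ≤ Rb}

/-- Sequences supported in `S` (vanishing at every index outside `S`): the space `V_{L,R}`. -/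
def suppIn (d : ℕ) (S : Set ℤ) : Submodule ℂ (SeqSp d) where
  carrier := {Ψ | ∀ j ∉ S, Ψ j = 0}
  add_mem' := by
    intro Ψ Φ hΨ hΦ j hj
    simp [Pi.add_apply, hΨ j hj, hΦ j hj]
  zero_mem' := fun j _ => rfl
  smul_mem' := by
    intro c Ψ hΨ j hj
    simp [Pi.smul_apply, hΨ j hj]

/-- Sequences vanishing at every index of `S`. -/
def vanishOn (d : ℕ) (S : Set ℤ) : Submodule ℂ (SeqSp d) where
  carrier := {Ψ | ∀ j ∈ S, Ψ j = 0}
  add_mem' := by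
    intro Ψ Φ hΨ hΦ j hj
    simp [Pi.add_apply, hΨ j hj, hΦ j hj]
  zero_mem' := fun j _ => rfl
  smul_mem' := by
    intro c Ψ hΨ j hj
    simp [Pi.smul_apply, hΨ j hj]

/-- The bulk solution space `M_{Lb,Rb} = Ker (P_{Lb−p',Rb−q'} 𝐀 |_{V_{Lb,Rb}})`, viewed as a
submodule of the full sequence space: sequences supported in the window `[Lb,Rb]` whose image
under `𝐀` vanishes on the bulk window `[Lb−p', Rb−q']` (with `p' = min p 0`, `q' = max q 0`). -/
def bulkSol (d : ℕ) (a : ℤ → Matrix (Fin d) (Fin d) ℂ) (p q : ℤ)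
    (Lb : WithBot ℤ) (Rb : WithTop ℤ) : Submodule ℂ (SeqSp d) :=
  suppIn d (windowSet Lb Rb) ⊓
    (vanishOn d (windowSet (Lb + ((-min p 0 : ℤ) : WithBot ℤ))
        (Rb + ((-max q 0 : ℤ) : WithTop ℤ)))).comap (bbl d a p q)

/-- Falling-factorial type product `j^{(v)} = (j−v+1)(j−v+2)⋯j`. -/
def ff (j : ℤ) (v : ℕ) : ℤ := ∏ i ∈ Finset.range v, (j - i)

/-- The scalar sequence `Φ_{z,v}`, with `j`-th entry `j^{(v−1)} z^{j−v+1}`, and `Φ_{z,0} = 0`. -/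
def Phi (z : ℂ) (v : ℕ) : ℤ → ℂ :=
  fun j => if v = 0 then 0 else (ff j (v - 1) : ℂ) * z ^ (j - (v : ℤ) + 1)

/-- The vector sequence `Φ_{z,v}|m⟩`. -/
def PhiVec (d : ℕ) (z : ℂ) (v : ℕ) (m : Fin d) : SeqSp d :=
  fun j => Phi z v j • (Pi.single m 1 : Fin d → ℂ)

/-- The subspace `T_{z,s} = Span{Φ_{z,v}|m⟩ : 1 ≤ v ≤ s, 1 ≤ m ≤ d}`. -/
def Tspace (d : ℕ) (z : ℂ) (s : ℕ) : Submodule ℂ (SeqSp d) :=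
  Submodule.span ℂ {Ψ : SeqSp d | ∃ v ∈ Finset.Icc 1 s, ∃ m : Fin d, Ψ = PhiVec d z v m}

/-- The symbol `A(w,w⁻¹) = ∑_{r=p}^q w^r a_r` as a matrix of Laurent polynomials. -/
def symbol (d : ℕ) (a : ℤ → Matrix (Fin d) (Fin d) ℂ) (p q : ℤ) :
    Matrix (Fin d) (Fin d) (LaurentPolynomial ℂ) :=
  ∑ r ∈ Finset.Icc p q, (LaurentPolynomial.T r : LaurentPolynomial ℂ) • (a r).map (fun c => LaurentPolynomial.C c)

/-- The evaluation `A(z,z⁻¹) = ∑_{r=p}^q z^r a_r` of the symbol at `z ≠ 0`. -/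
def symbolEval (d : ℕ) (a : ℤ → Matrix (Fin d) (Fin d) ℂ) (p q : ℤ) (z : ℂ) :
    Matrix (Fin d) (Fin d) ℂ :=
  ∑ r ∈ Finset.Icc p q, z ^ r • a r

/-- The `k`-th derivative `A^{(k)}(z,z⁻¹) = ∑_{r=p}^q r(r−1)⋯(r−k+1) z^{r−k} a_r`. -/
def symbolDeriv (d : ℕ) (a : ℤ → Matrix (Fin d) (Fin d) ℂ) (p q : ℤ) (k : ℕ) (z : ℂ) :
    Matrix (Fin d) (Fin d) ℂ :=
  ∑ r ∈ Finset.Icc p q, ((ff r k : ℂ) * z ^ (r - (k : ℤ))) • a r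

/-- The generalized kernel `⋃_k Ker (f^k)` of an endomorphism. -/
def genKer (d : ℕ) (f : Module.End ℂ (SeqSp d)) : Submodule ℂ (SeqSp d) :=
  ⨆ k : ℕ, LinearMap.ker (f ^ k)

/-- `F_L^− `: the generalized kernel of the unilateral shift `P_{L,∞}T` on `M_{L,∞}`. -/
def Fminus (d : ℕ) (a : ℤ → Matrix (Fin d) (Fin d) ℂ) (p q : ℤ) (L : ℤ) :
    Submodule ℂ (SeqSp d) :=
  bulkSol d a p q (L : WithBot ℤ) ⊤ ⊓
    genKer d (projOn d (windowSet (L : WithBot ℤ) ⊤) * shiftBy d 1)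

/-- `F_R^+`: the generalized kernel of the shift `P_{−∞,R}T⁻¹` on `M_{−∞,R}`. -/
def Fplus (d : ℕ) (a : ℤ → Matrix (Fin d) (Fin d) ℂ) (p q : ℤ) (R : ℤ) :
    Submodule ℂ (SeqSp d) :=
  bulkSol d a p q ⊥ (R : WithTop ℤ) ⊓
    genKer d (projOn d (windowSet ⊥ (R : WithTop ℤ)) * shiftBy d (-1))

/-- The left shift on scalar sequences. -/
def shiftS : Module.End ℂ (ℤ → ℂ) where
  toFun φ := fun j => φ (j + 1)
  map_add' _ _ := rfl
  map_smul' _ _ := rfl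

/-- The linear map on `SeqSp d` induced by a diagonal matrix polynomial with diagonal entries
`g m`: it acts on the `m`-th component of a sequence as `g m` evaluated at the left shift. -/
def diagPolyOp (d : ℕ) (g : Fin d → Polynomial ℂ) : Module.End ℂ (SeqSp d) where
  toFun Ψ := fun j m => Polynomial.aeval shiftS (g m) (fun i => Ψ i m) j
  map_add' Ψ Φ := by
    funext j m
    show Polynomial.aeval shiftS (g m) ((fun i => Ψ i m) + (fun i => Φ i m)) j = _
    rw [map_add]
    rfl
  map_smul' c Ψ := by
    funext j m
    show Polynomial.aeval shiftS (g m) (c • (fun i => Ψ i m)) j = _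
    rw [map_smul]
    rfl

/-- The subspace of sequences with values in `Span{|m⟩ : d₀ < m ≤ d}` (the range of `ρ_d(π)`). -/
def piRange (d d₀ : ℕ) : Submodule ℂ (SeqSp d) where
  carrier := {Ψ | ∀ j : ℤ, ∀ m : Fin d, (m : ℕ) < d₀ → Ψ j m = 0}
  add_mem' := by
    intro Ψ Φ hΨ hΦ j m hm
    simp [Pi.add_apply, hΨ j m hm, hΦ j m hm]
  zero_mem' := fun j m _ => rfl
  smul_mem' := by
    intro c Ψ hΨ j m hm
    simp [Pi.smul_apply, hΨ j m hm]

/-- The Hilbert space `H` of square-summable half-infinite sequences, as a subspace of `SeqSp d`: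
sequences vanishing at indices `j ≤ 0` whose restriction to `j ≥ 1` is in `ℓ²`. -/
def Hspace (d : ℕ) : Submodule ℂ (SeqSp d) where
  carrier := {Ψ | (∀ j : ℤ, j ≤ 0 → Ψ j = 0) ∧ Memℓp (fun n : ℕ => Ψ ((n : ℤ) + 1)) 2}
  add_mem' := by
    intro Ψ Φ hΨ hΦ
    refine ⟨fun j hj => by simp [Pi.add_apply, hΨ.1 j hj, hΦ.1 j hj], ?_⟩
    exact hΨ.2.add hΦ.2
  zero_mem' := ⟨fun j _ => rfl, zero_memℓp⟩
  smul_mem' := by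
    intro c Ψ hΨ
    exact ⟨fun j hj => by simp [Pi.smul_apply, hΨ.1 j hj], hΨ.2.const_smul c⟩


theorem shiftS_pow_apply (n : ℕ) (φ : ℤ → ℂ) (j : ℤ) : (shiftS ^ n) φ j = φ (j + n) := by
  induction n generalizing j with
  | zero => simp
  | succ n ih =>
    rw [pow_succ', Module.End.mul_apply]
    change (shiftS ^ n) φ (j + 1) = _
    rw [ih]
    congr 1
    push_cast
    ring

theorem shiftBy_one_pow_apply {d : ℕ} (n : ℕ) (Ψ : SeqSp d) (j : ℤ) :
    (shiftBy d 1 ^ n) Ψ j = Ψ (j + n) := by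
  induction n generalizing j with
  | zero => simp
  | succ n ih =>
    rw [pow_succ', Module.End.mul_apply]
    change (shiftBy d 1 ^ n) Ψ (j + 1) = _
    rw [ih]
    congr 1
    push_cast
    ring

theorem aeval_shiftS_apply (f : Polynomial ℂ) (φ : ℤ → ℂ) (j : ℤ) :
    Polynomial.aeval shiftS f φ j = f.sum fun i c => c * φ (j + i) := by
  rw [Polynomial.aeval_eq_sum_range, Polynomial.sum_over_range _ (by simp)]
  simp [LinearMap.sum_apply, Finset.sum_apply, shiftS_pow_apply]

theorem aeval_shiftBy_one_apply {d : ℕ} (f : Polynomial ℂ) (Ψ : SeqSp d) (j : ℤ) :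
    Polynomial.aeval (shiftBy d 1) f Ψ j = f.sum fun i c => c • Ψ (j + i) := by
  rw [Polynomial.aeval_eq_sum_range, Polynomial.sum_over_range _ (by simp)]
  simp [LinearMap.sum_apply, Finset.sum_apply, shiftBy_one_pow_apply]

theorem aeval_shiftBy_one_apply_apply {d : ℕ} (f : Polynomial ℂ) (Ψ : SeqSp d) (j : ℤ)
    (m : Fin d) :
    Polynomial.aeval (shiftBy d 1) f Ψ j m = Polynomial.aeval shiftS f (fun i => Ψ i m) j := by
  rw [aeval_shiftBy_one_apply, aeval_shiftS_apply]
  simp [Polynomial.sum_def, Finset.sum_apply]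

theorem bbl_apply {d : ℕ} (a : ℤ → Matrix (Fin d) (Fin d) ℂ) (p q : ℤ) (Ψ : SeqSp d) (j : ℤ) :
    bbl d a p q Ψ j = ∑ r ∈ Finset.Icc p q, (a r).mulVec (Ψ (j + r)) := by
  simp [bbl, matOp, shiftBy, LinearMap.sum_apply, Finset.sum_apply]

/-- BBL transformations commute with polynomials in the shift. -/
theorem bbl_aeval_shiftBy_one {d : ℕ} (a : ℤ → Matrix (Fin d) (Fin d) ℂ) (p q : ℤ)
    (f : Polynomial ℂ) (Ψ : SeqSp d) :
    bbl d a p q (Polynomial.aeval (shiftBy d 1) f Ψ) =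
      Polynomial.aeval (shiftBy d 1) f (bbl d a p q Ψ) := by
  funext j
  simp only [bbl_apply, aeval_shiftBy_one_apply, Polynomial.sum_def, Matrix.mulVec_sum,
    Matrix.mulVec_smul, Finset.smul_sum]
  rw [Finset.sum_comm]
  simp only [add_right_comm]

theorem aeval_mem_vanishOn_Ici {d : ℕ} {N : ℤ} (f : Polynomial ℂ) {Ψ : SeqSp d}
    (h : Ψ ∈ vanishOn d (Set.Ici N)) :
    Polynomial.aeval (shiftBy d 1) f Ψ ∈ vanishOn d (Set.Ici N) := by
  intro j hj
  rw [Set.mem_Ici] at hj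
  rw [aeval_shiftBy_one_apply, Polynomial.sum_def]
  refine Finset.sum_eq_zero fun i _ => ?_
  rw [h (j + i) (Set.mem_Ici.2 (by omega)), smul_zero]

theorem aeval_shiftBy_one_mul_apply {d : ℕ} (f g : Polynomial ℂ) (Ψ : SeqSp d) :
    Polynomial.aeval (shiftBy d 1) (f * g) Ψ =
      Polynomial.aeval (shiftBy d 1) f (Polynomial.aeval (shiftBy d 1) g Ψ) := by
  rw [map_mul, Module.End.mul_apply]

/-- A sequence annihilated by `Q(T)` with `Q(0) ≠ 0` vanishes if it is eventually zero. -/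
theorem eq_zero_of_aeval_eq_zero {d : ℕ} {Q : Polynomial ℂ} (hQ : IsCoprime Polynomial.X Q)
    {N : ℤ} {y : SeqSp d} (hy : Polynomial.aeval (shiftBy d 1) Q y = 0)
    (h : y ∈ vanishOn d (Set.Ici N)) : y = 0 := by
  funext j
  obtain ⟨u, v, huv⟩ := hQ.pow_left (m := (N - j).toNat)
  have hz : (shiftBy d 1 ^ (N - j).toNat) y ∈ vanishOn d (Set.Ici j) := by
    intro i hi
    rw [Set.mem_Ici] at hi
    rw [shiftBy_one_pow_apply]
    exact h _ (Set.mem_Ici.2 (by omega))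
  have h1 := congrArg (fun f => Polynomial.aeval (shiftBy d 1) f y) huv
  simp only [map_add, map_mul, map_pow, Polynomial.aeval_X, LinearMap.add_apply,
    Module.End.mul_apply, hy, map_zero, add_zero, map_one, Module.End.one_apply] at h1
  rw [← h1]
  exact aeval_mem_vanishOn_Ici u hz j (Set.mem_Ici.2 le_rfl)

/-- A one-sided solution of a recurrence `Q(T)Ψ = 0` with `Q(0) ≠ 0` extends to a two-sided one. -/
theorem exists_extension {d : ℕ} {Q : Polynomial ℂ} (hQ : IsCoprime Polynomial.X Q)
    {N : ℤ} {Ψ : SeqSp d}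
    (h : Polynomial.aeval (shiftBy d 1) Q Ψ ∈ vanishOn d (Set.Ici N)) :
    ∃ Φ : SeqSp d, Polynomial.aeval (shiftBy d 1) Q Φ = 0 ∧ Ψ - Φ ∈ vanishOn d (Set.Ici N) := by
  obtain ⟨g, v, hgv⟩ := hQ
  set ev : ℕ → ℕ → Fin d → ℂ := fun k l =>
    Polynomial.aeval (shiftBy d 1) (Polynomial.X ^ k * g ^ l) Ψ N with hev
  have step : ∀ k l, ev (k + 1) (l + 1) = ev k l := by
    intro k l
    have e : (Polynomial.X : Polynomial ℂ) ^ k * g ^ l =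
        Polynomial.X ^ (k + 1) * g ^ (l + 1) + Polynomial.X ^ k * g ^ l * v * Q := by
      linear_combination (-Polynomial.X ^ k * g ^ l) * hgv
    simp only [hev]
    rw [e, map_add, LinearMap.add_apply, aeval_shiftBy_one_mul_apply _ Q, Pi.add_apply,
      aeval_mem_vanishOn_Ici _ h N (Set.mem_Ici.2 le_rfl), add_zero]
  have steps : ∀ c k l, ev (k + c) (l + c) = ev k l := by
    intro c k l
    induction c with
    | zero => rfl
    | succ c ih => exact (step _ _).trans ih
  have evq : ∀ k l k' l' : ℕ, (k : ℤ) - l = k' - l' → ev k l = ev k' l' := by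
    intro k l k' l' he
    rcases le_total k k' with hk | hk
    · obtain ⟨c, rfl⟩ := Nat.exists_eq_add_of_le hk
      obtain rfl : l' = l + c := by omega
      exact (steps c k l).symm
    · obtain ⟨c, rfl⟩ := Nat.exists_eq_add_of_le hk
      obtain rfl : l = l' + c := by omega
      exact steps c k' l'
  refine ⟨fun j => ev (j - N).toNat (N - j).toNat, ?_, ?_⟩
  · funext j
    rw [aeval_shiftBy_one_apply, Polynomial.sum_def]
    have e : ∀ i : ℕ, ev (j + i - N).toNat (N - (j + i)).toNat =
        Polynomial.aeval (shiftBy d 1) (Polynomial.X ^ (j - N).toNat * g ^ (N - j).toNat) Ψ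
          (N + i) := by
      intro i
      rw [evq _ _ ((j - N).toNat + i) (N - j).toNat (by omega)]
      refine Eq.trans ?_ (shiftBy_one_pow_apply i _ N)
      simp only [hev]
      rw [pow_add, mul_right_comm, mul_comm _ (Polynomial.X ^ i), aeval_shiftBy_one_mul_apply]
      simp
    simp only [e]
    have := aeval_mem_vanishOn_Ici (Polynomial.X ^ (j - N).toNat * g ^ (N - j).toNat) h N
      (Set.mem_Ici.2 le_rfl)
    rw [← aeval_shiftBy_one_mul_apply, mul_comm, aeval_shiftBy_one_mul_apply, aeval_shiftBy_one_apply,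
      Polynomial.sum_def] at this
    exact this
  · intro j hj
    rw [Set.mem_Ici] at hj
    rw [Pi.sub_apply, sub_eq_zero]
    simp only [hev]
    rw [show (N - j).toNat = 0 by omega]
    simp only [pow_zero, mul_one, map_pow, Polynomial.aeval_X, shiftBy_one_pow_apply]
    congr 1
    omega

theorem ff_succ (j : ℤ) (k : ℕ) : ff j (k + 1) = ff j k * (j - k) := by
  simp [ff, Finset.prod_range_succ]

theorem ff_add_one_sub (j : ℤ) (k : ℕ) : ff (j + 1) (k + 1) - ff j (k + 1) = (k + 1) * ff j k := by
  have h : ff (j + 1) (k + 1) = (j + 1) * ff j k := by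
    simp only [ff]
    rw [Finset.prod_range_succ', mul_comm]
    congr 1
    · simp
    · refine Finset.prod_congr rfl fun i _ => ?_
      push_cast
      ring
  rw [h, ff_succ]
  ring

theorem ff_natCast (n k : ℕ) : ff (n : ℤ) k = (n.descFactorial k : ℤ) := by
  induction k with
  | zero => simp [ff]
  | succ k ih =>
    rw [ff_succ, ih, Nat.descFactorial_succ, mul_comm]
    rcases le_or_gt k n with h | h
    · push_cast [h]
      ring
    · simp [Nat.descFactorial_of_lt h]

theorem shiftBy_one_sub_PhiVec {d : ℕ} {z : ℂ} (hz : z ≠ 0) (v : ℕ) (m : Fin d) :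
    (shiftBy d 1 - algebraMap ℂ _ z) (PhiVec d z (v + 1) m) = (v : ℂ) • PhiVec d z v m := by
  funext j
  rw [LinearMap.sub_apply, Module.algebraMap_end_apply]
  change Phi z (v + 1) (j + 1) • (Pi.single m 1 : Fin d → ℂ) -
    z • Phi z (v + 1) j • (Pi.single m 1 : Fin d → ℂ) = (v : ℂ) • Phi z v j • _
  rw [smul_smul, smul_smul, ← sub_smul]
  congr 1
  rcases v with _ | v
  · simp only [Phi, ff]
    simp [zpow_add₀ hz, mul_comm]
  · have h := congrArg (fun t : ℤ => (t : ℂ)) (ff_add_one_sub j v)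
    simp only [Int.cast_sub, Int.cast_mul, Int.cast_add, Int.cast_one, Int.cast_natCast] at h
    simp only [Phi, Nat.add_sub_cancel, Nat.succ_ne_zero, if_false]
    have e1 : z ^ (j + 1 - ((v + 1 + 1 : ℕ) : ℤ) + 1) = z ^ (j - ((v + 1 : ℕ) : ℤ) + 1) := by
      congr 1
      push_cast
      ring
    have e2 : z * z ^ (j - ((v + 1 + 1 : ℕ) : ℤ) + 1) = z ^ (j - ((v + 1 : ℕ) : ℤ) + 1) := by
      rw [mul_comm, ← zpow_add_one₀ hz]
      congr 1
      push_cast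
      ring
    rw [e1, mul_left_comm, e2, ← sub_mul, h]
    push_cast
    ring

theorem PhiVec_mem_Tspace {d : ℕ} {z : ℂ} {s v : ℕ} (h1 : 1 ≤ v) (h2 : v ≤ s) (m : Fin d) :
    PhiVec d z v m ∈ Tspace d z s :=
  Submodule.subset_span ⟨v, Finset.mem_Icc.2 ⟨h1, h2⟩, m, rfl⟩

theorem Tspace_le_map {d : ℕ} {z : ℂ} (hz : z ≠ 0) (s : ℕ) :
    Tspace d z s ≤ (Tspace d z (s + 1)).map (shiftBy d 1 - algebraMap ℂ _ z) := by
  refine Submodule.span_le.2 ?_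
  rintro _ ⟨v, hv, m, rfl⟩
  obtain ⟨h1, h2⟩ := Finset.mem_Icc.1 hv
  refine ⟨(v : ℂ)⁻¹ • PhiVec d z (v + 1) m,
    Submodule.smul_mem _ _ (PhiVec_mem_Tspace (by omega) (by omega) m), ?_⟩
  have hv0 : (v : ℂ) ≠ 0 := by exact_mod_cast (show v ≠ 0 by omega)
  rw [map_smul, shiftBy_one_sub_PhiVec hz, inv_smul_smul₀ hv0]

theorem apply_add_of_shiftBy_one_sub_eq_zero {d : ℕ} {z : ℂ} {x : SeqSp d}
    (hx : (shiftBy d 1 - algebraMap ℂ _ z) x = 0) (j : ℤ) (n : ℕ) :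
    x (j + n) = z ^ n • x j := by
  have h : ∀ i, x (i + 1) = z • x i := fun i => by
    have := congrFun hx i
    rw [LinearMap.sub_apply, Module.algebraMap_end_apply] at this
    exact sub_eq_zero.1 this
  induction n with
  | zero => simp
  | succ n ih =>
    rw [Nat.cast_succ, ← add_assoc, h, ih, smul_smul, pow_succ']

theorem Tspace_eq_ker {d : ℕ} {z : ℂ} (hz : z ≠ 0) (s : ℕ) :
    Tspace d z s = LinearMap.ker ((shiftBy d 1 - algebraMap ℂ _ z) ^ s) := by
  apply le_antisymm
  · refine Submodule.span_le.2 ?_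
    rintro _ ⟨v, hv, m, rfl⟩
    obtain ⟨-, h2⟩ := Finset.mem_Icc.1 hv
    clear hv
    rw [SetLike.mem_coe, LinearMap.mem_ker]
    induction s generalizing v with
    | zero =>
      obtain rfl : v = 0 := by omega
      funext j
      simp [PhiVec, Phi]
    | succ s ih =>
      rcases v with _ | v
      · have : PhiVec d z 0 m = 0 := by
          funext j
          simp [PhiVec, Phi]
        rw [this, map_zero]
      · rw [pow_succ, Module.End.mul_apply, shiftBy_one_sub_PhiVec hz, map_smul,
          ih v (by omega), smul_zero]
  · induction s with
    | zero =>
      intro x hx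
      have : x = 0 := by simpa using hx
      rw [this]
      exact zero_mem _
    | succ s ih =>
      intro x hx
      rw [LinearMap.mem_ker, pow_succ, Module.End.mul_apply] at hx
      obtain ⟨y, hy, hyx⟩ := Tspace_le_map hz s (ih (LinearMap.mem_ker.2 hx))
      have hxy : (shiftBy d 1 - algebraMap ℂ _ z) (x - y) = 0 := by
        rw [map_sub, hyx, sub_self]
      have hsum : x - y = ∑ m, (x - y) 0 m • PhiVec d z 1 m := by
        have h := apply_add_of_shiftBy_one_sub_eq_zero hxy
        have hj : ∀ j : ℤ, (x - y) j = z ^ j • (x - y) 0 := by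
          intro j
          rcases le_total 0 j with hj | hj
          · have := h 0 j.toNat
            rw [zero_add, Int.toNat_of_nonneg hj] at this
            rw [this, ← zpow_natCast, Int.toNat_of_nonneg hj]
          · have := h j (-j).toNat
            rw [Int.toNat_of_nonneg (by omega), add_neg_cancel] at this
            rw [this, ← zpow_natCast, Int.toNat_of_nonneg (by omega), smul_smul,
              ← zpow_add₀ hz, add_neg_cancel, zpow_zero, one_smul]
        funext j m
        rw [hj, Finset.sum_apply, Finset.sum_apply]
        simp [PhiVec, Phi, ff, Pi.single_apply, mul_comm]
      rw [← sub_add_cancel x y, hsum]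
      exact add_mem (sum_mem fun m _ => Submodule.smul_mem _ _
        (PhiVec_mem_Tspace le_rfl (by omega) m)) hy

theorem mem_windowSet_top {L j : ℤ} : j ∈ windowSet (L : WithBot ℤ) ⊤ ↔ L ≤ j := by
  simp [windowSet]

theorem projOn_window_apply {d : ℕ} (L : ℤ) (Ψ : SeqSp d) (j : ℤ) :
    projOn d (windowSet (L : WithBot ℤ) ⊤) Ψ j = if L ≤ j then Ψ j else 0 := by
  split_ifs with h
  · exact Set.indicator_of_mem (mem_windowSet_top.2 h) Ψ
  · exact Set.indicator_of_notMem (fun h' => h (mem_windowSet_top.1 h')) Ψ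

theorem Tspace_le_comap_Hspace {d : ℕ} {z : ℂ} (hz0 : z ≠ 0) (hz : ‖z‖ < 1) (s : ℕ) :
    Tspace d z s ≤ (Hspace d).comap (projOn d (windowSet ((1 : ℤ) : WithBot ℤ) ⊤)) := by
  refine Submodule.span_le.2 ?_
  rintro _ ⟨v, hv, m, rfl⟩
  obtain ⟨h1, -⟩ := Finset.mem_Icc.1 hv
  refine ⟨fun j hj => ?_, memℓp_gen ?_⟩
  · rw [projOn_window_apply, if_neg (by omega)]
  · obtain ⟨k, rfl⟩ := Nat.exists_eq_add_of_le' h1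
    have hr : ‖‖z‖ ^ 2‖ < 1 := by
      rw [norm_pow, norm_norm]
      exact pow_lt_one₀ (norm_nonneg _) hz two_ne_zero
    have hgeo : Summable fun n : ℕ => (n : ℝ) ^ (2 * k) * (‖z‖ ^ 2) ^ n :=
      summable_pow_mul_geometric_of_norm_lt_one (2 * k) hr
    have hsum : Summable fun n : ℕ =>
        ((n + 1 : ℕ) : ℝ) ^ (2 * k) * (‖z‖ ^ 2) ^ (n + 1) * (‖z‖ ^ k)⁻¹ ^ 2 :=
      ((summable_nat_add_iff 1).2 hgeo).mul_right _
    refine Summable.of_nonneg_of_le (fun n => by positivity) (fun n => ?_) hsum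
    rw [projOn_window_apply, if_pos (by omega)]
    have e : ff ((n : ℤ) + 1) k = ((n + 1).descFactorial k : ℤ) := by
      rw [← ff_natCast]
      push_cast
      rfl
    have hn : ‖PhiVec d z (k + 1) m ((n : ℤ) + 1)‖ =
        ((n + 1).descFactorial k : ℝ) * (‖z‖ ^ (n + 1) * (‖z‖ ^ k)⁻¹) := by
      simp only [PhiVec, Phi, norm_smul, Pi.norm_single, norm_one, mul_one, Nat.add_sub_cancel,
        Nat.succ_ne_zero, if_false, e, norm_mul, Int.cast_natCast, RCLike.norm_natCast, norm_zpow]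
      congr 1
      rw [show (n : ℤ) + 1 - ((k + 1 : ℕ) : ℤ) + 1 = ((n + 1 : ℕ) : ℤ) - (k : ℤ) by
        push_cast; ring, zpow_sub₀ (norm_ne_zero_iff.2 hz0), zpow_natCast, zpow_natCast,
        div_eq_mul_inv]
    have hle : ((n + 1).descFactorial k : ℝ) ≤ ((n + 1 : ℕ) : ℝ) ^ k := by
      exact_mod_cast Nat.descFactorial_le_pow (n + 1) k
    rw [hn]
    simp only [ENNReal.toReal_ofNat, Real.rpow_ofNat]
    calc _ ≤ (((n + 1 : ℕ) : ℝ) ^ k * (‖z‖ ^ (n + 1) * (‖z‖ ^ k)⁻¹)) ^ 2 := by gcongr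
      _ = _ := by ring

/-- The matrix polynomial `∑_r w^{r-p} a_r`. -/
def polySymbol (d : ℕ) (a : ℤ → Matrix (Fin d) (Fin d) ℂ) (p q : ℤ) :
    Matrix (Fin d) (Fin d) (Polynomial ℂ) :=
  fun m k => ∑ r ∈ Finset.Icc p q, Polynomial.C (a r m k) * Polynomial.X ^ (r - p).toNat

theorem eval_det_polySymbol {d : ℕ} (a : ℤ → Matrix (Fin d) (Fin d) ℂ) (p q : ℤ) {w : ℂ}
    (hw : w ≠ 0) :
    (polySymbol d a p q).det.eval w = w ^ (-((d : ℤ) * p)) * (symbolEval d a p q w).det := by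
  have h : (polySymbol d a p q).map (Polynomial.evalRingHom w) =
      w ^ (-p) • symbolEval d a p q w := by
    ext m k
    simp only [polySymbol, symbolEval, Matrix.map_apply, Matrix.smul_apply, Matrix.sum_apply,
      Polynomial.coe_evalRingHom, Polynomial.eval_finsetSum, smul_eq_mul, Finset.mul_sum]
    refine Finset.sum_congr rfl fun r hr => ?_
    have hr := (Finset.mem_Icc.1 hr).1
    rw [Polynomial.eval_mul, Polynomial.eval_C, Polynomial.eval_pow, Polynomial.eval_X,
      ← mul_assoc, ← zpow_add₀ hw, ← zpow_natCast, Int.toNat_of_nonneg (by omega), mul_comm]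
    congr 2
    ring
  rw [← Polynomial.coe_evalRingHom, RingHom.map_det, RingHom.mapMatrix_apply, h, Matrix.det_smul,
    Fintype.card_fin, ← zpow_natCast, ← zpow_mul]
  congr 2
  ring

theorem sum_aeval_polySymbol {d : ℕ} (a : ℤ → Matrix (Fin d) (Fin d) ℂ) (p q : ℤ) (Ψ : SeqSp d)
    (m : Fin d) :
    ∑ k, Polynomial.aeval shiftS (polySymbol d a p q m k) (fun i => Ψ i k) =
      fun j => bbl d a p q Ψ (j - p) m := by
  funext j
  simp only [bbl_apply, polySymbol, map_sum, map_mul, map_pow, Polynomial.aeval_C,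
    Polynomial.aeval_X, LinearMap.sum_apply, Finset.sum_apply, Module.End.mul_apply,
    Module.algebraMap_end_apply, Pi.smul_apply, shiftS_pow_apply, Matrix.mulVec, dotProduct,
    smul_eq_mul]
  rw [Finset.sum_comm]
  refine Finset.sum_congr rfl fun r hr => Finset.sum_congr rfl fun k _ => ?_
  have hr := (Finset.mem_Icc.1 hr).1
  congr 2
  omega

/-- If `𝐀Ψ` vanishes far to the right, then so does `(det A)(T)Ψ`. -/
theorem aeval_det_mem_vanishOn {d : ℕ} (a : ℤ → Matrix (Fin d) (Fin d) ℂ) (p q : ℤ) {N : ℤ}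
    {Ψ : SeqSp d} (h : bbl d a p q Ψ ∈ vanishOn d (Set.Ici N)) :
    Polynomial.aeval (shiftBy d 1) (polySymbol d a p q).det Ψ ∈
      vanishOn d (Set.Ici (N + p)) := by
  intro j hj
  rw [Set.mem_Ici] at hj
  funext l
  rw [aeval_shiftBy_one_apply_apply]
  set M := polySymbol d a p q with hM
  have key : Polynomial.aeval shiftS M.det (fun i => Ψ i l) =
      ∑ m, Polynomial.aeval shiftS (M.adjugate l m)
        (fun j => bbl d a p q Ψ (j - p) m) := by
    simp only [← sum_aeval_polySymbol, ← hM, map_sum, ← Module.End.mul_apply, ← map_mul]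
    rw [Finset.sum_comm]
    simp only [← LinearMap.sum_apply, ← map_sum, ← Matrix.mul_apply, Matrix.adjugate_mul]
    rw [Finset.sum_eq_single l]
    · simp
    · intro k _ hk
      simp [Matrix.one_apply_ne hk.symm]
    · simp
  rw [key, Finset.sum_apply]
  refine Finset.sum_eq_zero fun m _ => ?_
  rw [aeval_shiftS_apply, Polynomial.sum_def]
  refine Finset.sum_eq_zero fun i _ => ?_
  rw [h _ (Set.mem_Ici.2 (by omega)), Pi.zero_apply, mul_zero]

open Filter Topology in
theorem tendsto_aeval {d : ℕ} (f : Polynomial ℂ) {Ψ : SeqSp d} (h : Tendsto Ψ atTop (𝓝 0)) :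
    Tendsto (Polynomial.aeval (shiftBy d 1) f Ψ) atTop (𝓝 0) := by
  have e : Polynomial.aeval (shiftBy d 1) f Ψ =
      fun j => ∑ i ∈ f.support, f.coeff i • Ψ (j + i) := by
    funext j
    rw [aeval_shiftBy_one_apply, Polynomial.sum_def]
  rw [e, ← Finset.sum_const_zero (s := f.support)]
  refine tendsto_finsetSum _ fun i _ => ?_
  rw [← smul_zero (f.coeff i)]
  exact (h.comp (tendsto_atTop_add_const_right _ _ tendsto_id)).const_smul _

open Filter Topology in
/-- A generalized eigenvector of the shift with eigenvalue of modulus at least one does not decay. -/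
theorem eq_zero_of_tendsto {d : ℕ} {z : ℂ} (hz : 1 ≤ ‖z‖) (s : ℕ) {x : SeqSp d}
    (hx : ((shiftBy d 1 - algebraMap ℂ _ z) ^ s) x = 0) (h : Tendsto x atTop (𝓝 0)) : x = 0 := by
  induction s generalizing x with
  | zero => simpa using hx
  | succ s ih =>
    rw [pow_succ, Module.End.mul_apply] at hx
    have hy := ih hx <| by
      have := tendsto_aeval (Polynomial.X - Polynomial.C z) h
      rwa [map_sub, Polynomial.aeval_X, Polynomial.aeval_C] at this
    funext j
    have ht : Tendsto (fun n : ℕ => ‖x (j + n)‖) atTop (𝓝 0) := by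
      rw [← norm_zero (E := Fin d → ℂ)]
      exact (h.comp (tendsto_atTop_add_const_left _ _ tendsto_natCast_atTop_atTop)).norm
    have hle : ‖x j‖ ≤ 0 := ge_of_tendsto' ht fun n => by
      rw [apply_add_of_shiftBy_one_sub_eq_zero hy, norm_smul, norm_pow]
      exact le_mul_of_one_le_left (norm_nonneg _) (one_le_pow₀ hz)
    simpa using hle

open Filter Topology in
theorem tendsto_of_mem_Hspace {d : ℕ} {Ψ : SeqSp d} (h : Ψ ∈ Hspace d) :
    Tendsto Ψ atTop (𝓝 0) := by
  have hs := (h.2.summable (by norm_num)).tendsto_atTop_zero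
  simp only [ENNReal.toReal_ofNat, Real.rpow_ofNat] at hs
  have h1 : Tendsto (fun n : ℕ => ‖Ψ ((n : ℤ) + 1)‖) atTop (𝓝 0) := by
    have := hs.sqrt
    simpa [Real.sqrt_sq] using this
  have h2 : Tendsto (fun j : ℤ => Ψ (((j - 1).toNat : ℤ) + 1)) atTop (𝓝 0) := by
    refine (tendsto_zero_iff_norm_tendsto_zero.2 h1).comp (tendsto_atTop.2 fun b => ?_)
    filter_upwards [eventually_ge_atTop ((b : ℤ) + 1)] with j hj
    omega
  refine h2.congr' ?_
  filter_upwards [eventually_ge_atTop 1] with j hj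
  congr 1
  omega

theorem vanishOn_Ici_mono {d : ℕ} {N N' : ℤ} (h : N ≤ N') :
    vanishOn d (Set.Ici N) ≤ vanishOn d (Set.Ici N') :=
  fun _ hΨ j hj => hΨ j (Set.mem_Ici.2 (h.trans hj))

theorem projOn_mul_shiftBy_pow_apply {d : ℕ} {L j : ℤ} (hj : L ≤ j) (k : ℕ) (Ψ : SeqSp d) :
    ((projOn d (windowSet (L : WithBot ℤ) ⊤) * shiftBy d 1) ^ k) Ψ j = Ψ (j + k) := by
  induction k generalizing j with
  | zero => simp
  | succ k ih =>
    rw [pow_succ', Module.End.mul_apply, Module.End.mul_apply, projOn_window_apply, if_pos hj]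
    change ((projOn d (windowSet (L : WithBot ℤ) ⊤) * shiftBy d 1) ^ k) Ψ (j + 1) = _
    rw [ih (by omega)]
    congr 1
    push_cast
    ring

/-- The generalized kernel of the unilateral shift consists of finitely supported sequences. -/
theorem mem_genKer_iff {d : ℕ} {L : ℤ} {Ψ : SeqSp d} :
    Ψ ∈ genKer d (projOn d (windowSet (L : WithBot ℤ) ⊤) * shiftBy d 1) ↔
      ∃ N, Ψ ∈ vanishOn d (Set.Ici N) := by
  set f := projOn d (windowSet (L : WithBot ℤ) ⊤) * shiftBy d 1 with hf
  have hmono : Monotone fun k : ℕ => LinearMap.ker (f ^ k) :=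
    monotone_nat_of_le_succ fun k x hx => by
      rw [LinearMap.mem_ker] at hx ⊢
      rw [pow_succ', Module.End.mul_apply, hx, map_zero]
  rw [genKer, Submodule.mem_iSup_of_directed _ hmono.directed_le]
  constructor
  · rintro ⟨k, hk⟩
    refine ⟨L + k, fun j hj => ?_⟩
    rw [Set.mem_Ici] at hj
    have := congrFun (LinearMap.mem_ker.1 hk) (j - k)
    rwa [hf, projOn_mul_shiftBy_pow_apply (by omega), sub_add_cancel] at this
  · rintro ⟨N, hN⟩
    refine ⟨(N - L).toNat + 1, LinearMap.mem_ker.2 (funext fun j => ?_)⟩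
    by_cases hj : L ≤ j
    · rw [hf, projOn_mul_shiftBy_pow_apply hj]
      exact hN _ (Set.mem_Ici.2 (by push_cast; omega))
    · rw [pow_succ', Module.End.mul_apply, hf, Module.End.mul_apply, projOn_window_apply,
        if_neg hj]
      rfl

theorem mem_bulkSol_one_iff {d : ℕ} {a : ℤ → Matrix (Fin d) (Fin d) ℂ} {p q : ℤ} {Ψ : SeqSp d} :
    Ψ ∈ bulkSol d a p q ((1 : ℤ) : WithBot ℤ) ⊤ ↔
      (∀ j < 1, Ψ j = 0) ∧ bbl d a p q Ψ ∈ vanishOn d (Set.Ici (1 - min p 0)) := by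
  have hw : ((1 : ℤ) : WithBot ℤ) + ((-min p 0 : ℤ) : WithBot ℤ) =
      ((1 - min p 0 : ℤ) : WithBot ℤ) := by
    rw [← WithBot.coe_add, sub_eq_add_neg]
  rw [bulkSol, Submodule.mem_inf, Submodule.mem_comap, hw, WithTop.top_add]
  refine and_congr (forall_congr' fun j => ?_) (forall_congr' fun j => ?_)
  · rw [mem_windowSet_top, not_le]
  · rw [mem_windowSet_top, Set.mem_Ici]

/-- `𝐀Ψ` far enough to the right only depends on the entries of `Ψ` on a right half-line. -/
theorem bbl_mem_vanishOn {d : ℕ} (a : ℤ → Matrix (Fin d) (Fin d) ℂ) (p q : ℤ) {N : ℤ}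
    {Ψ : SeqSp d} (h : Ψ ∈ vanishOn d (Set.Ici N)) :
    bbl d a p q Ψ ∈ vanishOn d (Set.Ici (N - p)) := by
  intro j hj
  rw [Set.mem_Ici] at hj
  rw [bbl_apply]
  refine Finset.sum_eq_zero fun r hr => ?_
  have := (Finset.mem_Icc.1 hr).1
  rw [h _ (Set.mem_Ici.2 (by omega)), Matrix.mulVec_zero]

theorem sub_projOn_mem_vanishOn {d : ℕ} (L : ℤ) (Ψ : SeqSp d) :
    Ψ - projOn d (windowSet (L : WithBot ℤ) ⊤) Ψ ∈ vanishOn d (Set.Ici L) := fun j hj => by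
  rw [Pi.sub_apply, projOn_window_apply, if_pos (Set.mem_Ici.1 hj), sub_self]

theorem projOn_mem_bulkSol {d : ℕ} {a : ℤ → Matrix (Fin d) (Fin d) ℂ} {p q : ℤ} {Ψ : SeqSp d}
    (h : bbl d a p q Ψ = 0) :
    projOn d (windowSet ((1 : ℤ) : WithBot ℤ) ⊤) Ψ ∈
      bulkSol d a p q ((1 : ℤ) : WithBot ℤ) ⊤ := by
  refine mem_bulkSol_one_iff.2 ⟨fun j hj => ?_, ?_⟩
  · rw [projOn_window_apply, if_neg (by omega)]
  · have := bbl_mem_vanishOn a p q (sub_projOn_mem_vanishOn 1 Ψ)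
    rw [map_sub, h, zero_sub, neg_mem_iff] at this
    exact vanishOn_Ici_mono (by omega) this

/-- Finitely supported half-infinite sequences are square-summable. -/
theorem mem_Hspace_of_vanishOn {d : ℕ} {N : ℤ} {Ψ : SeqSp d} (h0 : ∀ j < 1, Ψ j = 0)
    (h : Ψ ∈ vanishOn d (Set.Ici N)) : Ψ ∈ Hspace d := by
  refine ⟨fun j hj => h0 j (by omega), memℓp_gen ?_⟩
  refine summable_of_ne_finset_zero (s := Finset.range N.toNat) fun n hn => ?_
  rw [Finset.mem_range, not_lt] at hn
  rw [h _ (Set.mem_Ici.2 (by omega)), norm_zero]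
  simp

/-- A polynomial whose nonzero roots are among the `z ℓ` divides, up to a power of the variable,
the product of the corresponding primary factors. -/
theorem dvd_X_pow_mul_prod {P : Polynomial ℂ} (hP0 : P ≠ 0) {n : ℕ} {z : Fin n → ℂ}
    (hz0 : ∀ ℓ, z ℓ ≠ 0) (hzinj : Function.Injective z)
    (hall : ∀ w : ℂ, w ≠ 0 → P.IsRoot w → ∃ ℓ, z ℓ = w) :
    ∃ m : ℕ, P ∣ Polynomial.X ^ m *
      ∏ ℓ, (Polynomial.X - Polynomial.C (z ℓ)) ^ P.rootMultiplicity (z ℓ) := by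
  classical
  refine ⟨P.rootMultiplicity 0, ?_⟩
  have h := (IsAlgClosed.splits P).eq_prod_roots
  rw [Polynomial.prod_multiset_root_eq_finset_root] at h
  have hsub : P.roots.toFinset ⊆ insert 0 (Finset.univ.image z) := by
    intro w hw
    rw [Multiset.mem_toFinset] at hw
    by_cases hw0 : w = 0
    · simp [hw0]
    · obtain ⟨ℓ, rfl⟩ := hall w hw0 (Polynomial.isRoot_of_mem_roots hw)
      simp
  have hd := Finset.prod_dvd_prod_of_subset _ _
    (fun w => (Polynomial.X - Polynomial.C w) ^ P.rootMultiplicity w) hsub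
  rw [Finset.prod_insert (by simpa using hz0), Finset.prod_image hzinj.injOn, map_zero,
    sub_zero] at hd
  conv_lhs => rw [h]
  exact (Polynomial.isUnit_C.2 (Polynomial.leadingCoeff_ne_zero.2 hP0).isUnit).mul_left_dvd.2 hd

/-- Primary decomposition of a solution of `Q(T)x = 0`, by polynomials in `T`. -/
theorem exists_primary_decomposition {d n : ℕ} {z : Fin n → ℂ} (hzinj : Function.Injective z)
    (s : Fin n → ℕ) {x : SeqSp d}
    (hx : Polynomial.aeval (shiftBy d 1)
      (∏ ℓ, (Polynomial.X - Polynomial.C (z ℓ)) ^ s ℓ) x = 0) :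
    ∃ e : Fin n → Polynomial ℂ, x = ∑ ℓ, Polynomial.aeval (shiftBy d 1) (e ℓ) x ∧
      ∀ ℓ, ((shiftBy d 1 - algebraMap ℂ _ (z ℓ)) ^ s ℓ)
        (Polynomial.aeval (shiftBy d 1) (e ℓ) x) = 0 := by
  classical
  rcases isEmpty_or_nonempty (Fin n) with hn | hn
  · exact ⟨isEmptyElim, by simpa using hx, isEmptyElim⟩
  obtain ⟨μ, hμ⟩ := exists_sum_eq_one_iff_pairwise_coprime'.2
    (fun i j hij => (Polynomial.pairwise_coprime_X_sub_C hzinj hij).pow (m := s i) (n := s j))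
  refine ⟨fun ℓ => μ ℓ * ∏ j ∈ {ℓ}ᶜ, (Polynomial.X - Polynomial.C (z j)) ^ s j, ?_, fun ℓ => ?_⟩
  · rw [← LinearMap.sum_apply, ← map_sum, hμ, map_one, Module.End.one_apply]
  · have e : (shiftBy d 1 - algebraMap ℂ _ (z ℓ)) ^ s ℓ =
        Polynomial.aeval (shiftBy d 1) ((Polynomial.X - Polynomial.C (z ℓ)) ^ s ℓ) := by
      simp
    rw [e, ← aeval_shiftBy_one_mul_apply, mul_left_comm, ← Fintype.prod_eq_mul_prod_compl ℓ
        fun j => (Polynomial.X - Polynomial.C (z j)) ^ s j,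
      aeval_shiftBy_one_mul_apply, hx, map_zero]

theorem stmt_19 (d : ℕ) (hd : 1 ≤ d) (p q : ℤ) (hpq : p ≤ q)
    (a : ℤ → Matrix (Fin d) (Fin d) ℂ) (hap : a p ≠ 0) (haq : a q ≠ 0)
    (hreg : (symbol d a p q).det ≠ 0)
    (P : Polynomial ℂ) (hP0 : P ≠ 0)
    (hP : ∀ w : ℂ, w ≠ 0 → P.eval w = w ^ (-((d : ℤ) * p)) * (symbolEval d a p q w).det)
    (n : ℕ) (z : Fin n → ℂ) (hz0 : ∀ ℓ, z ℓ ≠ 0) (hzinj : Function.Injective z)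
    (hroot : ∀ ℓ, P.IsRoot (z ℓ))
    (hall : ∀ w : ℂ, w ≠ 0 → P.IsRoot w → ∃ ℓ, z ℓ = w)
    (s : Fin n → ℕ) (hs : ∀ ℓ, s ℓ = P.rootMultiplicity (z ℓ)) :
    bulkSol d a p q ((1 : ℤ) : WithBot ℤ) ⊤ ⊓ Hspace d
        = Fminus d a p q 1
            ⊔ (⨆ ℓ : {ℓ : Fin n // ‖z ℓ‖ < 1},
                (LinearMap.ker (bbl d a p q) ⊓ Tspace d (z ℓ) (s ℓ)).map
                  (projOn d (windowSet ((1 : ℤ) : WithBot ℤ) ⊤))) ∧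
      Disjoint (Fminus d a p q 1)
        (⨆ ℓ : {ℓ : Fin n // ‖z ℓ‖ < 1},
          (LinearMap.ker (bbl d a p q) ⊓ Tspace d (z ℓ) (s ℓ)).map
            (projOn d (windowSet ((1 : ℤ) : WithBot ℤ) ⊤))) := by
  obtain rfl : s = fun ℓ => P.rootMultiplicity (z ℓ) := funext hs
  have hdet : (polySymbol d a p q).det = P := by
    refine Polynomial.eq_of_infinite_eval_eq _ _
      ((Set.finite_singleton (0 : ℂ)).infinite_compl.mono fun w hw => ?_)
    rw [Set.mem_ofPred_eq, eval_det_polySymbol a p q hw, hP w hw]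
  set Q : Polynomial ℂ :=
    ∏ ℓ, (Polynomial.X - Polynomial.C (z ℓ)) ^ P.rootMultiplicity (z ℓ) with hQdef
  have hQ : IsCoprime Polynomial.X Q := by
    refine IsCoprime.prod_right fun ℓ _ => IsCoprime.pow_right ?_
    have := Polynomial.isCoprime_X_sub_C_of_isUnit_sub (a := (0 : ℂ)) (b := z ℓ)
      (by simpa using hz0 ℓ)
    rwa [map_zero, sub_zero] at this
  have htail : ∀ N (Ψ : SeqSp d), bbl d a p q Ψ ∈ vanishOn d (Set.Ici N) →
      ∃ N', Polynomial.aeval (shiftBy d 1) Q Ψ ∈ vanishOn d (Set.Ici N') := by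
    intro N Ψ hΨ
    obtain ⟨m, g, hg⟩ := dvd_X_pow_mul_prod hP0 hz0 hzinj hall
    have hc : Polynomial.aeval (shiftBy d 1) (Polynomial.X ^ m * Q) Ψ ∈
        vanishOn d (Set.Ici (N + p)) := by
      rw [hg, mul_comm, aeval_shiftBy_one_mul_apply, ← hdet]
      exact aeval_mem_vanishOn_Ici _ (aeval_det_mem_vanishOn a p q hΨ)
    refine ⟨N + p + m, fun j hj => ?_⟩
    rw [Set.mem_Ici] at hj
    have := hc (j - m) (Set.mem_Ici.2 (by omega))
    rwa [aeval_shiftBy_one_mul_apply, map_pow, Polynomial.aeval_X, shiftBy_one_pow_apply,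
      sub_add_cancel] at this
  have hker : ∀ ℓ, LinearMap.ker (bbl d a p q) ⊓ Tspace d (z ℓ) (P.rootMultiplicity (z ℓ)) ≤
      LinearMap.ker (Polynomial.aeval (shiftBy d 1) Q) := by
    rintro ℓ x ⟨-, hx⟩
    rw [SetLike.mem_coe, Tspace_eq_ker (hz0 ℓ), LinearMap.mem_ker] at hx
    rw [LinearMap.mem_ker, hQdef, ← Finset.prod_erase_mul _ _ (Finset.mem_univ ℓ),
      aeval_shiftBy_one_mul_apply, map_pow, map_sub, Polynomial.aeval_X, Polynomial.aeval_C, hx,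
      map_zero]
  refine ⟨le_antisymm ?_ (sup_le ?_ (iSup_le ?_)), ?_⟩
  · rintro Ψ ⟨hM, hH⟩
    obtain ⟨h0, hb⟩ := mem_bulkSol_one_iff.1 hM
    obtain ⟨N, hN⟩ := htail _ _ hb
    obtain ⟨Φ, hΦ, hΨΦ⟩ := exists_extension hQ hN
    have hA : bbl d a p q Φ = 0 := by
      refine eq_zero_of_aeval_eq_zero (N := max (N - p) (1 - min p 0)) hQ
        (by rw [← bbl_aeval_shiftBy_one, hΦ, map_zero]) ?_
      rw [← sub_sub_cancel Ψ Φ, map_sub]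
      exact sub_mem (vanishOn_Ici_mono (le_max_right _ _) hb)
        (vanishOn_Ici_mono (le_max_left _ _) (bbl_mem_vanishOn a p q hΨΦ))
    have hlim : Filter.Tendsto Φ Filter.atTop (nhds 0) := by
      refine (tendsto_of_mem_Hspace hH).congr' ?_
      filter_upwards [Filter.eventually_ge_atTop N] with j hj
      exact sub_eq_zero.1 (hΨΦ j hj)
    obtain ⟨e, hsum, he⟩ := exists_primary_decomposition hzinj _ hΦ
    have hres : projOn d (windowSet ((1 : ℤ) : WithBot ℤ) ⊤) Φ ∈
        ⨆ ℓ : {ℓ : Fin n // ‖z ℓ‖ < 1},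
          (LinearMap.ker (bbl d a p q) ⊓ Tspace d (z ℓ) (P.rootMultiplicity (z ℓ))).map
            (projOn d (windowSet ((1 : ℤ) : WithBot ℤ) ⊤)) := by
      rw [hsum, map_sum]
      refine sum_mem fun ℓ _ => ?_
      by_cases hℓ : ‖z ℓ‖ < 1
      · refine Submodule.mem_iSup_of_mem ⟨ℓ, hℓ⟩ (Submodule.mem_map_of_mem ⟨?_, ?_⟩)
        · rw [SetLike.mem_coe, LinearMap.mem_ker, bbl_aeval_shiftBy_one, hA, map_zero]
        · rw [SetLike.mem_coe, Tspace_eq_ker (hz0 ℓ)]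
          exact he ℓ
      · rw [eq_zero_of_tendsto (not_lt.1 hℓ) _ (he ℓ) (tendsto_aeval (e ℓ) hlim), map_zero]
        exact zero_mem _
    rw [← sub_add_cancel Ψ (projOn d (windowSet ((1 : ℤ) : WithBot ℤ) ⊤) Φ)]
    refine Submodule.add_mem_sup ⟨sub_mem hM (projOn_mem_bulkSol hA), mem_genKer_iff.2 ?_⟩ hres
    refine ⟨max N 1, ?_⟩
    rw [← sub_add_sub_cancel Ψ Φ]
    exact add_mem (vanishOn_Ici_mono (le_max_left _ _) hΨΦ)
      (vanishOn_Ici_mono (le_max_right _ _) (sub_projOn_mem_vanishOn 1 Φ))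
  · rintro x ⟨hM, hx⟩
    obtain ⟨N, hN⟩ := mem_genKer_iff.1 hx
    exact ⟨hM, mem_Hspace_of_vanishOn (mem_bulkSol_one_iff.1 hM).1 hN⟩
  · rintro ⟨ℓ, hℓ⟩ _ ⟨x, ⟨hx, hT⟩, rfl⟩
    exact ⟨projOn_mem_bulkSol hx, Tspace_le_comap_Hspace (hz0 ℓ) hℓ _ hT⟩
  · refine Submodule.disjoint_def.2 fun x hF hx => ?_
    obtain ⟨N, hN⟩ := mem_genKer_iff.1 hF.2
    have hle := iSup_le fun ℓ : {ℓ : Fin n // ‖z ℓ‖ < 1} =>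
      Submodule.map_mono (f := projOn d (windowSet ((1 : ℤ) : WithBot ℤ) ⊤)) (hker ℓ)
    obtain ⟨y, hy, rfl⟩ := hle hx
    have hy0 : y = 0 := by
      refine eq_zero_of_aeval_eq_zero (N := max N 1) hQ (LinearMap.mem_ker.1 hy) ?_
      rw [← sub_add_cancel y (projOn d (windowSet ((1 : ℤ) : WithBot ℤ) ⊤) y)]
      exact add_mem (vanishOn_Ici_mono (le_max_right _ _) (sub_projOn_mem_vanishOn 1 y))
        (vanishOn_Ici_mono (le_max_left _ _) hN)
    rw [hy0, map_zero]

end
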